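/- Let (Z, 𝒜, P) be a probability space, M > 0, F a countable nonempty set of measurable functions f : Z → [0, M], and φ : ℝ → ℝ a disutility function that is Lipschitz with constant L. For every n ≥ 1 and δ ∈ (0,1], the n-fold product measure P^n of the set of samples (z₁,...,zₙ) ∈ Z^n on which the following holds is at least 1 − δ: every f̂ ∈ F attaining the minimum of OCE_φ(·;P_n) over F satisfies OCE_φ(f̂;P) ≤ inf_{f∈F} OCE_φ(f;P) + L·( 4·E_{P^n}[Rad_n(F(Z^n))] + 2M·(2 + √(log(2/δ)))/√n ), where P_n is the empirical measure of (z₁,...,zₙ). -/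

import Mathlib

open MeasureTheory Finset Set ENNReal

/-- A disutility function: nondecreasing, convex, `φ(0) = 0`, and `1 ∈ ∂φ(0)` (i.e. `φ(t) ≥ t`). -/
def IsDisutility (φ : ℝ → ℝ) : Prop :=
  Monotone φ ∧ ConvexOn ℝ Set.univ φ ∧ φ 0 = 0 ∧ ∀ t : ℝ, t ≤ φ t

/-- The optimized certainty equivalent risk `OCE_φ(f;Q) = inf_λ (λ + ∫ φ(f − λ) dQ)`. -/
noncomputable def OCE {Z : Type*} [MeasurableSpace Z] (φ : ℝ → ℝ) (f : Z → ℝ) (Q : Measure Z) : ℝ :=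
  ⨅ lam : ℝ, (lam + ∫ z, φ (f z - lam) ∂Q)

/-- The inverted OCE risk `IOCE_φ(f;Q) = sup_λ (λ − ∫ φ(λ − f) dQ)`. -/
noncomputable def IOCE {Z : Type*} [MeasurableSpace Z] (φ : ℝ → ℝ) (f : Z → ℝ) (Q : Measure Z) : ℝ :=
  ⨆ lam : ℝ, (lam - ∫ z, φ (lam - f z) ∂Q)

/-- The empirical measure `(1/n)·Σᵢ δ_{zᵢ}` of a sample `z : Fin n → Z`. -/
noncomputable def empMeas {Z : Type*} [MeasurableSpace Z] {n : ℕ} (z : Fin n → Z) : Measure Z :=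
  (n : ℝ≥0∞)⁻¹ • ∑ i : Fin n, Measure.dirac (z i)

/-- The Rademacher average of a function class `F` on a sample `z`:
`2^{-n}·Σ_{ε ∈ {−1,1}ⁿ} sup_{f∈F} (1/n)·Σᵢ εᵢ f(zᵢ)`. -/
noncomputable def rad {Z : Type*} {n : ℕ} (F : Set (Z → ℝ)) (z : Fin n → Z) : ℝ :=
  (2 ^ n : ℝ)⁻¹ * ∑ ε : Fin n → Bool,
    ⨆ f : F, (n : ℝ)⁻¹ * ∑ i : Fin n, (if ε i then (1 : ℝ) else -1) * (f : Z → ℝ) (z i)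

section BoundedDifferences

variable {Z : Type*} [MeasurableSpace Z] (P : Measure Z) [IsProbabilityMeasure P]

theorem integrable_of_measurable_of_abs_le {Ω : Type*} [MeasurableSpace Ω] {μ : Measure Ω}
    [IsFiniteMeasure μ] {X : Ω → ℝ} (hX : Measurable X) {B : ℝ} (hB : ∀ ω, |X ω| ≤ B) :
    Integrable X μ :=
  Integrable.of_bound hX.aestronglyMeasurable B (Filter.Eventually.of_forall hB)

theorem measurePreserving_finCons (n : ℕ) :
    MeasurePreserving (fun p : Z × (Fin n → Z) => (Fin.cons p.1 p.2 : Fin (n + 1) → Z))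
      (P.prod (Measure.pi fun _ : Fin n => P)) (Measure.pi fun _ : Fin (n + 1) => P) := by
  have h := (measurePreserving_piFinSuccAbove (fun _ : Fin (n + 1) => P) 0).symm
  convert h using 1
  ext p i
  simp [MeasurableEquiv.piFinSuccAbove, Fin.insertNthEquiv]

theorem integral_pi_succ {n : ℕ} {G : (Fin (n + 1) → Z) → ℝ} (hG : Measurable G)
    {B : ℝ} (hB : ∀ z, |G z| ≤ B) :
    ∫ z, G z ∂(Measure.pi fun _ : Fin (n + 1) => P) =
      ∫ x, ∫ w, G (Fin.cons x w) ∂(Measure.pi fun _ : Fin n => P) ∂P := by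
  have hmp := measurePreserving_finCons P n
  rw [← hmp.map_eq, integral_map hmp.measurable.aemeasurable hG.aestronglyMeasurable,
    integral_prod]
  exact integrable_of_measurable_of_abs_le (hG.comp hmp.measurable) fun p => hB _

theorem abs_integral_le_of_abs_le {Ω : Type*} [MeasurableSpace Ω] (μ : Measure Ω)
    [IsProbabilityMeasure μ] {X : Ω → ℝ} {B : ℝ} (hB : ∀ ω, |X ω| ≤ B) :
    |∫ ω, X ω ∂μ| ≤ B := by
  simpa using norm_integral_le_of_norm_le_const (f := X) (μ := μ) (Filter.Eventually.of_forall hB)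

/-- Hoeffding's lemma for a random variable of oscillation at most `c`. -/
theorem integral_exp_centered_le {Ω : Type*} [MeasurableSpace Ω] (μ : Measure Ω)
    [IsProbabilityMeasure μ] {X : Ω → ℝ} (hX : Measurable X) {c : ℝ}
    (hc : ∀ x y, |X x - X y| ≤ c) (t : ℝ) :
    ∫ x, Real.exp (t * (X x - ∫ y, X y ∂μ)) ∂μ ≤ Real.exp ((c / 2) ^ 2 * t ^ 2 / 2) := by
  obtain ⟨x₀⟩ : Nonempty Ω := μ.nonempty_of_neZero
  have hbdd : BddBelow (Set.range X) := by
    refine ⟨X x₀ - c, ?_⟩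
    rintro _ ⟨x, rfl⟩
    linarith [(abs_le.1 (hc x x₀)).1]
  have : Nonempty Ω := ⟨x₀⟩
  have hmem : ∀ x, X x ∈ Set.Icc (⨅ y, X y) ((⨅ y, X y) + c) := by
    intro x
    refine ⟨ciInf_le hbdd x, ?_⟩
    have : X x - c ≤ ⨅ y, X y := le_ciInf fun y => by linarith [(abs_le.1 (hc x y)).2]
    linarith
  have h := (ProbabilityTheory.hasSubgaussianMGF_of_mem_Icc (μ := μ) hX.aemeasurable
    (Filter.Eventually.of_forall hmem)).mgf_le t
  simpa [ProbabilityTheory.mgf, div_pow] using h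

theorem abs_exp_mul_sub_le {t a b B : ℝ} (ha : |a| ≤ B) (hb : |b| ≤ B) :
    |Real.exp (t * (a - b))| ≤ Real.exp (|t| * (B + B)) := by
  rw [Real.abs_exp]
  apply Real.exp_le_exp.2
  refine (le_abs_self _).trans ?_
  rw [abs_mul]
  gcongr
  exact (abs_sub a b).trans (add_le_add ha hb)

/-- Exponential moment bound behind McDiarmid's bounded differences inequality. -/
theorem integral_exp_le_of_boundedDifferences (c B t : ℝ) (n : ℕ) (G : (Fin n → Z) → ℝ)
    (hG : Measurable G) (hB : ∀ z, |G z| ≤ B)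
    (hc : ∀ z i x, |G (Function.update z i x) - G z| ≤ c) :
    ∫ z, Real.exp (t * (G z - ∫ w, G w ∂(Measure.pi fun _ : Fin n => P)))
      ∂(Measure.pi fun _ : Fin n => P) ≤ Real.exp (n * ((c / 2) ^ 2 * t ^ 2 / 2)) := by
  induction n with
  | zero =>
    have hz : ∀ z, G z = G default := fun z => congrArg G (Subsingleton.elim _ _)
    simp [hz]
  | succ n ih =>
    have hcons := (measurePreserving_finCons P n).measurable
    set μ := Measure.pi fun _ : Fin n => P with hμ
    have hGx : ∀ x, Measurable fun w : Fin n → Z => G (Fin.cons x w) := fun x =>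
      hG.comp (hcons.comp measurable_prodMk_left)
    set g : Z → ℝ := fun x => ∫ w, G (Fin.cons x w) ∂μ with hg
    have hgm : Measurable g :=
      (hG.comp hcons).stronglyMeasurable.integral_prod_right'.measurable
    have hgB : ∀ x, |g x| ≤ B := fun x => abs_integral_le_of_abs_le μ fun w => hB _
    have hgi : ∀ x, Integrable (fun w : Fin n → Z => G (Fin.cons x w)) μ := fun x =>
      integrable_of_measurable_of_abs_le (hGx x) fun w => hB _
    have hgc : ∀ x y, |g x - g y| ≤ c := by
      intro x y
      rw [hg, ← integral_sub (hgi x) (hgi y)]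
      refine abs_integral_le_of_abs_le μ fun w => ?_
      simpa using hc (Fin.cons y w) 0 x
    rw [integral_pi_succ P hG hB]
    change ∫ z, Real.exp (t * (G z - ∫ x, g x ∂P)) ∂_ ≤ _
    set m := ∫ x, g x ∂P
    have hm : |m| ≤ B := abs_integral_le_of_abs_le P hgB
    rw [integral_pi_succ P (by fun_prop) (B := Real.exp (|t| * (B + B)))
      fun z => abs_exp_mul_sub_le (hB z) hm]
    have hinner : ∀ x, ∫ w, Real.exp (t * (G (Fin.cons x w) - m)) ∂μ ≤
        Real.exp (t * (g x - m)) * Real.exp (n * ((c / 2) ^ 2 * t ^ 2 / 2)) := by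
      intro x
      have h := ih (fun w => G (Fin.cons x w)) (hGx x) (fun w => hB _) (fun w i y => by
        have := hc (Fin.cons x w) i.succ y
        rwa [← Fin.cons_update] at this)
      have heq : ∀ w, Real.exp (t * (G (Fin.cons x w) - m)) =
          Real.exp (t * (g x - m)) * Real.exp (t * (G (Fin.cons x w) - g x)) := by
        intro w
        rw [← Real.exp_add]
        ring_nf
      simp_rw [heq]
      rw [integral_const_mul]
      exact mul_le_mul_of_nonneg_left h (Real.exp_pos _).le
    have hint : Integrable (fun x => Real.exp (t * (g x - m))) P :=
      integrable_of_measurable_of_abs_le (by fun_prop) fun x => abs_exp_mul_sub_le (hgB x) hm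
    calc ∫ x, ∫ w, Real.exp (t * (G (Fin.cons x w) - m)) ∂μ ∂P
        ≤ ∫ x, Real.exp (t * (g x - m)) * Real.exp (n * ((c / 2) ^ 2 * t ^ 2 / 2)) ∂P := by
          refine integral_mono ?_ (hint.mul_const _) hinner
          refine integrable_of_measurable_of_abs_le (B := Real.exp (|t| * (B + B))) ?_ ?_
          · have : Measurable fun p : Z × (Fin n → Z) =>
                Real.exp (t * (G (Fin.cons p.1 p.2) - m)) := by
              have := hG.comp hcons
              simp only [Function.comp_def] at this
              fun_prop
            exact this.stronglyMeasurable.integral_prod_right'.measurable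
          · exact fun x => abs_integral_le_of_abs_le μ fun w => abs_exp_mul_sub_le (hB _) hm
      _ = (∫ x, Real.exp (t * (g x - m)) ∂P) * Real.exp (n * ((c / 2) ^ 2 * t ^ 2 / 2)) :=
          integral_mul_const _ _
      _ ≤ Real.exp ((c / 2) ^ 2 * t ^ 2 / 2) * Real.exp (n * ((c / 2) ^ 2 * t ^ 2 / 2)) := by
          gcongr
          exact integral_exp_centered_le P hgm hgc t
      _ = Real.exp (((n + 1 : ℕ) : ℝ) * ((c / 2) ^ 2 * t ^ 2 / 2)) := by
          rw [← Real.exp_add]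
          push_cast
          ring_nf

/-- **McDiarmid's inequality** for independent, identically distributed coordinates. -/
theorem measure_ge_le_of_boundedDifferences {c B : ℝ} {n : ℕ} {G : (Fin n → Z) → ℝ}
    (hG : Measurable G) (hB : ∀ z, |G z| ≤ B)
    (hc : ∀ z i x, |G (Function.update z i x) - G z| ≤ c) {ε : ℝ} (hε : 0 ≤ ε) :
    (Measure.pi fun _ : Fin n => P).real
      {z | ε ≤ G z - ∫ w, G w ∂(Measure.pi fun _ : Fin n => P)} ≤
      Real.exp (-ε ^ 2 / (2 * (n * (c / 2) ^ 2))) := by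
  have h : ProbabilityTheory.HasSubgaussianMGF
      (fun z => G z - ∫ w, G w ∂(Measure.pi fun _ : Fin n => P))
      (Real.toNNReal (n * (c / 2) ^ 2)) (Measure.pi fun _ : Fin n => P) := by
    refine ⟨fun t => ?_, fun t => ?_⟩
    · exact integrable_of_measurable_of_abs_le (by fun_prop)
        fun z => abs_exp_mul_sub_le (hB z) (abs_integral_le_of_abs_le _ hB)
    · rw [Real.coe_toNNReal _ (by positivity)]
      refine (integral_exp_le_of_boundedDifferences P c B t n G hG hB hc).trans_eq ?_
      ring_nf
  have h' := h.measure_ge_le hε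
  rwa [Real.coe_toNNReal _ (by positivity)] at h'

end BoundedDifferences

section Contraction

/-- The sign attached to a Boolean. -/
noncomputable def boolSign (b : Bool) : ℝ := if b then 1 else -1

theorem abs_boolSign (b : Bool) : |boolSign b| = 1 := by
  cases b <;> simp [boolSign]

theorem boolSign_not (b : Bool) : boolSign (!b) = -boolSign b := by
  cases b <;> simp [boolSign]

theorem sum_fin_succ_bool {n : ℕ} (g : (Fin (n + 1) → Bool) → ℝ) :
    ∑ ε, g ε = ∑ ε : Fin n → Bool, (g (Fin.cons true ε) + g (Fin.cons false ε)) := by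
  rw [← (Fin.consEquiv fun _ => Bool).sum_comp, Fintype.sum_prod_type, Fintype.sum_bool,
    ← Finset.sum_add_distrib]
  rfl

theorem bddAbove_range_of_abs_le {ι : Type*} {a : ι → ℝ} {B : ℝ} (h : ∀ i, |a i| ≤ B) :
    BddAbove (Set.range a) := by
  refine ⟨B, ?_⟩
  rintro _ ⟨i, rfl⟩
  exact (abs_le.1 (h i)).2

theorem abs_iSup_le {ι : Type*} [Nonempty ι] {a : ι → ℝ} {B : ℝ} (h : ∀ i, |a i| ≤ B) :
    |⨆ i, a i| ≤ B := by
  obtain ⟨i⟩ := ‹Nonempty ι›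
  have : Nonempty ι := ⟨i⟩
  refine abs_le.2 ⟨?_, ciSup_le fun i => (abs_le.1 (h i)).2⟩
  exact (abs_le.1 (h i)).1.trans (le_ciSup (bddAbove_range_of_abs_le h) i)

theorem abs_iSup_sub_iSup_le {ι : Type*} [Nonempty ι] {a b : ι → ℝ} {B d : ℝ}
    (ha : ∀ i, |a i| ≤ B) (hb : ∀ i, |b i| ≤ B) (hd : ∀ i, |a i - b i| ≤ d) :
    |(⨆ i, a i) - ⨆ i, b i| ≤ d := by
  have h1 : ⨆ i, a i ≤ (⨆ i, b i) + d := ciSup_le fun i => by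
    linarith [(abs_le.1 (hd i)).2, le_ciSup (bddAbove_range_of_abs_le hb) i]
  have h2 : ⨆ i, b i ≤ (⨆ i, a i) + d := ciSup_le fun i => by
    linarith [(abs_le.1 (hd i)).1, le_ciSup (bddAbove_range_of_abs_le ha) i]
  exact abs_le.2 ⟨by linarith, by linarith⟩

theorem abs_boolSign_sum_le {n : ℕ} (ε : Fin n → Bool) {a : Fin n → ℝ} {B : ℝ}
    (h : ∀ k, |a k| ≤ B) : |∑ k, boolSign (ε k) * a k| ≤ n * B := by
  refine (Finset.abs_sum_le_sum_abs _ _).trans ?_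
  refine (Finset.sum_le_card_nsmul _ _ B fun k _ => ?_).trans_eq (by simp)
  rw [abs_mul, abs_boolSign, one_mul]
  exact h k

theorem iSup_add_iSup_contraction {ι : Type*} [Nonempty ι] {ψ : ℝ → ℝ} {L : ℝ}
    (hψ : ∀ x y, |ψ x - ψ y| ≤ L * |x - y|) {u v : ι → ℝ} {A B : ℝ}
    (hu : ∀ i, |u i| ≤ A) (hv : ∀ i, |v i| ≤ B) :
    (⨆ i, (u i + ψ (v i))) + (⨆ i, (u i - ψ (v i))) ≤
      (⨆ i, (u i + L * v i)) + ⨆ i, (u i - L * v i) := by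
  have hLv : ∀ i, |L * v i| ≤ |L| * B := fun i => by
    rw [abs_mul]
    exact mul_le_mul_of_nonneg_left (hv i) (abs_nonneg _)
  have hp : BddAbove (Set.range fun i => u i + L * v i) :=
    bddAbove_range_of_abs_le fun i => (abs_add_le _ _).trans (add_le_add (hu i) (hLv i))
  have hm : BddAbove (Set.range fun i => u i - L * v i) :=
    bddAbove_range_of_abs_le fun i => (abs_sub _ _).trans (add_le_add (hu i) (hLv i))
  rw [← le_sub_iff_add_le]
  refine ciSup_le fun i => ?_
  rw [le_sub_comm]
  refine ciSup_le fun j => ?_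
  have h1 := le_ciSup hp i
  have h2 := le_ciSup hm i
  have h3 := le_ciSup hp j
  have h4 := le_ciSup hm j
  have h5 := (le_abs_self _).trans (hψ (v i) (v j))
  rcases abs_cases (v i - v j) with ⟨h, _⟩ | ⟨h, _⟩ <;> rw [h] at h5 <;> linarith

/-- The Ledoux–Talagrand contraction principle for Rademacher sums, without absolute values. -/
theorem sum_iSup_contraction {ι : Type*} [Nonempty ι] {ψ : ℝ → ℝ} {L : ℝ}
    (hψ : ∀ x y, |ψ x - ψ y| ≤ L * |x - y|) (n : ℕ) (u : ι → ℝ) (v : ι → Fin n → ℝ) (A B : ℝ)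
    (hu : ∀ i, |u i| ≤ A) (hv : ∀ i k, |v i k| ≤ B) :
    ∑ ε : Fin n → Bool, ⨆ i, (u i + ∑ k, boolSign (ε k) * ψ (v i k)) ≤
      ∑ ε : Fin n → Bool, ⨆ i, (u i + ∑ k, boolSign (ε k) * (L * v i k)) := by
  induction n generalizing u A with
  | zero => simp
  | succ n ih =>
    have hψv : ∀ i, |ψ (v i 0)| ≤ |ψ 0| + |L| * B := fun i => by
      have h1 := hψ (v i 0) 0
      have h2 := abs_sub_abs_le_abs_sub (ψ (v i 0)) (ψ 0)
      have h3 : L * |v i 0 - 0| ≤ |L| * B := by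
        rw [sub_zero]
        exact mul_le_mul (le_abs_self _) (hv i 0) (abs_nonneg _) (abs_nonneg _)
      linarith
    simp only [sum_fin_succ_bool, Fin.sum_univ_succ, Fin.cons_zero, Fin.cons_succ,
      Finset.sum_add_distrib, ← add_assoc]
    have hb : ∀ b, ∀ i, |u i + boolSign b * ψ (v i 0)| ≤ A + (|ψ 0| + |L| * B) := fun b i => by
      refine (abs_add_le _ _).trans (add_le_add (hu i) ?_)
      rw [abs_mul, abs_boolSign, one_mul]
      exact hψv i
    refine (add_le_add
      (ih (fun i => u i + boolSign true * ψ (v i 0)) (fun i k => v i k.succ) _ (hb true)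
        fun i k => hv i _)
      (ih (fun i => u i + boolSign false * ψ (v i 0)) (fun i k => v i k.succ) _ (hb false)
        fun i k => hv i _)).trans ?_
    rw [← Finset.sum_add_distrib, ← Finset.sum_add_distrib]
    refine Finset.sum_le_sum fun ε _ => ?_
    have hw : ∀ i, |u i + ∑ k : Fin n, boolSign (ε k) * (L * v i k.succ)| ≤
        A + n * (|L| * B) := fun i => by
      refine (abs_add_le _ _).trans (add_le_add (hu i) (abs_boolSign_sum_le ε fun k => ?_))
      rw [abs_mul]
      exact mul_le_mul_of_nonneg_left (hv i _) (abs_nonneg _)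
    convert iSup_add_iSup_contraction hψ hw (fun i => hv i 0) using 3
    · rfl
    all_goals
      funext i
      simp only [boolSign, if_true, Bool.false_eq_true, if_false]
      ring

theorem sum_sq_boolSign_sum (n : ℕ) :
    ∑ ε : Fin n → Bool, (∑ k, boolSign (ε k)) ^ 2 = n * 2 ^ n := by
  induction n with
  | zero => simp
  | succ n ih =>
    simp only [sum_fin_succ_bool, Fin.sum_univ_succ, Fin.cons_zero, Fin.cons_succ]
    have h : ∀ s : ℝ, (boolSign true + s) ^ 2 + (boolSign false + s) ^ 2 = 2 + 2 * s ^ 2 := by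
      intro s
      simp only [boolSign, if_true, Bool.false_eq_true, if_false]
      ring
    simp only [h, Finset.sum_add_distrib, ← Finset.mul_sum, ih]
    simp
    ring

theorem sum_abs_boolSign_sum_le (n : ℕ) :
    ∑ ε : Fin n → Bool, |∑ k, boolSign (ε k)| ≤ 2 ^ n * √n := by
  have h := sq_sum_le_card_mul_sum_sq (s := Finset.univ)
    (f := fun ε : Fin n → Bool => |∑ k, boolSign (ε k)|)
  simp only [sq_abs, sum_sq_boolSign_sum] at h
  refine le_of_sq_le_sq (h.trans_eq ?_) (by positivity)
  rw [mul_pow, Real.sq_sqrt (by positivity)]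
  simp
  ring

end Contraction

section Symmetrization

/-- The Rademacher average of a family of sample vectors. -/
noncomputable def radAvg {ι : Type*} {n : ℕ} (a : ι → Fin n → ℝ) : ℝ :=
  (2 ^ n : ℝ)⁻¹ * ∑ ε : Fin n → Bool, ⨆ i, (n : ℝ)⁻¹ * ∑ k, boolSign (ε k) * a i k

theorem abs_inv_mul_boolSign_sum_le {n : ℕ} (ε : Fin n → Bool) {a : Fin n → ℝ} {B : ℝ}
    (hn : 0 < n) (h : ∀ k, |a k| ≤ B) : |(n : ℝ)⁻¹ * ∑ k, boolSign (ε k) * a k| ≤ B := by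
  have hn' : (0 : ℝ) < n := Nat.cast_pos.2 hn
  rw [abs_mul, abs_of_pos (inv_pos.2 hn'), inv_mul_le_iff₀ hn']
  exact abs_boolSign_sum_le ε h

theorem abs_inv_mul_sum_le {n : ℕ} {a : Fin n → ℝ} {B : ℝ}
    (hn : 0 < n) (h : ∀ k, |a k| ≤ B) : |(n : ℝ)⁻¹ * ∑ k, a k| ≤ B := by
  simpa [boolSign] using abs_inv_mul_boolSign_sum_le (fun _ => true) hn h

theorem abs_radAvg_le {ι : Type*} [Nonempty ι] {n : ℕ} (hn : 0 < n) {a : ι → Fin n → ℝ} {B : ℝ}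
    (h : ∀ i k, |a i k| ≤ B) : |radAvg a| ≤ B := by
  rw [radAvg, abs_mul, abs_of_pos (by positivity), inv_mul_le_iff₀ (by positivity)]
  refine (Finset.abs_sum_le_sum_abs _ _).trans ?_
  refine (Finset.sum_le_card_nsmul _ _ B fun ε _ =>
    abs_iSup_le fun i => abs_inv_mul_boolSign_sum_le ε hn (h i)).trans_eq ?_
  simp

variable {Z : Type*} [MeasurableSpace Z] {ι : Type*}

theorem measurable_iSup_boolSign_sum [Countable ι] {n : ℕ} {h : ι → Z → ℝ} (hm : ∀ i, Measurable (h i))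
    (ε : Fin n → Bool) :
    Measurable fun z : Fin n → Z => ⨆ i, (n : ℝ)⁻¹ * ∑ k, boolSign (ε k) * h i (z k) := by
  refine Measurable.iSup fun i => ?_
  have := hm i
  fun_prop

theorem measurable_radAvg [Countable ι] {n : ℕ} {h : ι → Z → ℝ} (hm : ∀ i, Measurable (h i)) :
    Measurable fun z : Fin n → Z => radAvg fun i k => h i (z k) := by
  unfold radAvg
  have := measurable_iSup_boolSign_sum (n := n) hm
  fun_prop

variable (P : Measure Z)

/-- The largest one-sided deviation between population and sample means over the family `h`. -/
noncomputable def supDev {n : ℕ} (h : ι → Z → ℝ) (z : Fin n → Z) : ℝ :=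
  ⨆ i, (∫ x, h i x ∂P - (n : ℝ)⁻¹ * ∑ k, h i (z k))

theorem measurable_supDev [Countable ι] {n : ℕ} {h : ι → Z → ℝ} (hm : ∀ i, Measurable (h i)) :
    Measurable fun z : Fin n → Z => supDev P h z := by
  refine Measurable.iSup fun i => ?_
  have := hm i
  fun_prop

variable [IsProbabilityMeasure P]

theorem abs_dev_le {n : ℕ} (hn : 0 < n) {h : ι → Z → ℝ} {B : ℝ}
    (hB : ∀ i x, |h i x| ≤ B) (z : Fin n → Z) (i : ι) :
    |∫ x, h i x ∂P - (n : ℝ)⁻¹ * ∑ k, h i (z k)| ≤ B + B :=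
  (abs_sub _ _).trans (add_le_add (abs_integral_le_of_abs_le P (hB i))
    (abs_inv_mul_sum_le hn fun k => hB i (z k)))

theorem integral_sample_mean {n : ℕ} (hn : 0 < n) {g : Z → ℝ} (hm : Measurable g) {B : ℝ}
    (hB : ∀ x, |g x| ≤ B) :
    ∫ z, (n : ℝ)⁻¹ * ∑ k, g (z k) ∂(Measure.pi fun _ : Fin n => P) = ∫ x, g x ∂P := by
  have hn' : (n : ℝ) ≠ 0 := by positivity
  rw [integral_const_mul, integral_finsetSum]
  · have : ∀ k : Fin n, ∫ z, g (z k) ∂(Measure.pi fun _ : Fin n => P) = ∫ x, g x ∂P := fun k =>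
      integral_comp_eval (μ := fun _ : Fin n => P) hm.aestronglyMeasurable
    simp [this, hn']
  · exact fun k _ => integrable_of_measurable_of_abs_le (by fun_prop) fun z => hB (z k)

theorem integral_supDev_le_integral_ghost [Countable ι] [Nonempty ι] {n : ℕ} (hn : 0 < n) {h : ι → Z → ℝ}
    (hm : ∀ i, Measurable (h i)) {B : ℝ} (hB : ∀ i x, |h i x| ≤ B) :
    ∫ z, supDev P h z ∂(Measure.pi fun _ : Fin n => P) ≤
      ∫ y, ⨆ i, (n : ℝ)⁻¹ * ∑ k, (h i (y k).2 - h i (y k).1)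
        ∂(Measure.pi fun _ : Fin n => P.prod P) := by
  set μ := Measure.pi fun _ : Fin n => P
  set K : (Fin n → Z) × (Fin n → Z) → ℝ :=
    fun p => ⨆ i, (n : ℝ)⁻¹ * ∑ k, (h i (p.2 k) - h i (p.1 k)) with hK
  have hd : ∀ (p : (Fin n → Z) × (Fin n → Z)) i,
      |(n : ℝ)⁻¹ * ∑ k, (h i (p.2 k) - h i (p.1 k))| ≤ B + B := fun p i =>
    abs_inv_mul_sum_le hn fun k => (abs_sub _ _).trans (add_le_add (hB i _) (hB i _))
  have hKm : Measurable K := Measurable.iSup fun i => by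
    have := hm i
    fun_prop
  have hKB : ∀ p, |K p| ≤ B + B := fun p => abs_iSup_le (hd p)
  have hmp := measurePreserving_arrowProdEquivProdArrow Z Z (Fin n) (fun _ => P) (fun _ => P)
  have hprod : ∫ y, ⨆ i, (n : ℝ)⁻¹ * ∑ k, (h i (y k).2 - h i (y k).1)
      ∂(Measure.pi fun _ : Fin n => P.prod P) = ∫ p, K p ∂(μ.prod μ) :=
    hmp.integral_comp' (g := K)
  have hKi : Integrable K (μ.prod μ) := integrable_of_measurable_of_abs_le hKm hKB
  rw [hprod, integral_prod _ hKi]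
  refine integral_mono ?_ hKi.integral_prod_left fun z => ciSup_le fun i => ?_
  · exact integrable_of_measurable_of_abs_le (measurable_supDev P hm)
      fun z => abs_iSup_le (abs_dev_le P hn hB z)
  · have hmi := hm i
    have hint : Integrable (fun w : Fin n → Z => (n : ℝ)⁻¹ * ∑ k, h i (w k)) μ :=
      integrable_of_measurable_of_abs_le (by fun_prop)
        fun w => abs_inv_mul_sum_le hn fun k => hB i (w k)
    have heq : ∫ x, h i x ∂P - (n : ℝ)⁻¹ * ∑ k, h i (z k) =
        ∫ w, (n : ℝ)⁻¹ * ∑ k, (h i (w k) - h i (z k)) ∂μ := by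
      simp only [Finset.sum_sub_distrib, mul_sub]
      rw [integral_sub hint (integrable_const _), integral_sample_mean P hn hmi (hB i)]
      simp
    rw [heq]
    refine integral_mono ?_ ?_ fun w =>
      le_ciSup (bddAbove_range_of_abs_le (hd (z, w))) i
    · exact integrable_of_measurable_of_abs_le (by fun_prop) fun w => hd (z, w) i
    · exact integrable_of_measurable_of_abs_le (hKm.comp measurable_prodMk_left)
        fun w => hKB (z, w)

/-- Symmetrization: the expected largest deviation is at most twice the expected Rademacher
average. -/
theorem integral_supDev_le [Countable ι] [Nonempty ι] {n : ℕ} (hn : 0 < n) {h : ι → Z → ℝ}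
    (hm : ∀ i, Measurable (h i)) {B : ℝ} (hB : ∀ i x, |h i x| ≤ B) :
    ∫ z, supDev P h z ∂(Measure.pi fun _ : Fin n => P) ≤
      2 * ∫ z, (radAvg fun i k => h i (z k)) ∂(Measure.pi fun _ : Fin n => P) := by
  refine (integral_supDev_le_integral_ghost P hn hm hB).trans ?_
  set μ := Measure.pi fun _ : Fin n => P with hμ
  set ν := Measure.pi fun _ : Fin n => P.prod P with hν
  set S : (Fin n → Bool) → (Fin n → Z) → ℝ :=
    fun ε z => ⨆ i, (n : ℝ)⁻¹ * ∑ k, boolSign (ε k) * h i (z k) with hS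
  have hSm : ∀ ε, Measurable (S ε) := fun ε => measurable_iSup_boolSign_sum hm ε
  have hSb : ∀ (ε : Fin n → Bool) (z : Fin n → Z) i, |(n : ℝ)⁻¹ * ∑ k, boolSign (ε k) * h i (z k)| ≤ B := fun ε z i =>
    abs_inv_mul_boolSign_sum_le ε hn fun k => hB i (z k)
  have hSB : ∀ ε z, |S ε z| ≤ B := fun ε z => abs_iSup_le (hSb ε z)
  set K : (Fin n → Z × Z) → ℝ :=
    fun y => ⨆ i, (n : ℝ)⁻¹ * ∑ k, (h i (y k).2 - h i (y k).1) with hK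
  have hKm : Measurable K := Measurable.iSup fun i => by
    have := hm i
    fun_prop
  have hfst : MeasurePreserving (fun (y : Fin n → Z × Z) k => (y k).1) ν μ :=
    measurePreserving_pi _ _ fun _ => measurePreserving_fst
  have hsnd : MeasurePreserving (fun (y : Fin n → Z × Z) k => (y k).2) ν μ :=
    measurePreserving_pi _ _ fun _ => measurePreserving_snd
  have hcomp : ∀ {T : (Fin n → Z × Z) → Fin n → Z}, MeasurePreserving T ν μ → ∀ ε,
      ∫ y, S ε (T y) ∂ν = ∫ z, S ε z ∂μ := by
    intro T hT ε
    rw [← hT.map_eq, integral_map hT.measurable.aemeasurable (hSm ε).aestronglyMeasurable]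
  have hbound : ∀ ε : Fin n → Bool, ∫ y, K y ∂ν ≤
      ∫ z, S ε z ∂μ + ∫ z, S (fun k => !ε k) z ∂μ := by
    intro ε
    set T : (Fin n → Z × Z) → Fin n → Z × Z :=
      fun y k => (if ε k then id else Prod.swap) (y k) with hT
    have hTp : MeasurePreserving T ν ν := by
      refine measurePreserving_pi _ _ fun k => ?_
      split_ifs
      · exact MeasurePreserving.id _
      · exact Measure.measurePreserving_swap
    have hswap : ∫ y, K y ∂ν = ∫ y, K (T y) ∂ν := by
      conv_lhs => rw [← hTp.map_eq]
      rw [integral_map hTp.measurable.aemeasurable hKm.aestronglyMeasurable]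
    have hi1 : Integrable (fun y : Fin n → Z × Z => S ε fun k => (y k).2) ν :=
      integrable_of_measurable_of_abs_le ((hSm ε).comp hsnd.measurable) fun y => hSB _ _
    have hi2 : Integrable (fun y : Fin n → Z × Z => S (fun k => !ε k) fun k => (y k).1) ν :=
      integrable_of_measurable_of_abs_le ((hSm _).comp hfst.measurable) fun y => hSB _ _
    have hKb : ∀ y, |K y| ≤ B + B := fun y => abs_iSup_le fun i =>
      abs_inv_mul_sum_le hn fun k => (abs_sub _ _).trans (add_le_add (hB i _) (hB i _))
    rw [hswap, ← hcomp hsnd ε, ← hcomp hfst fun k => !ε k, ← integral_add hi1 hi2]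
    refine integral_mono ?_ (hi1.add hi2) fun y => ciSup_le fun i => ?_
    · exact integrable_of_measurable_of_abs_le (hKm.comp hTp.measurable) fun y => hKb _
    · have h1 := le_ciSup (bddAbove_range_of_abs_le (hSb ε fun k => (y k).2)) i
      have h2 := le_ciSup (bddAbove_range_of_abs_le (hSb (fun k => !ε k) fun k => (y k).1)) i
      refine le_trans (le_of_eq ?_) (add_le_add h1 h2)
      rw [← mul_add, ← Finset.sum_add_distrib]
      congr 1
      refine Finset.sum_congr rfl fun k _ => ?_
      rw [boolSign_not]
      simp only [hT, boolSign]
      split_ifs <;> simp <;> ring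
  have hsum : ∑ _ε : Fin n → Bool, ∫ y, K y ∂ν ≤ 2 * ∑ ε : Fin n → Bool, ∫ z, S ε z ∂μ := by
    refine (Finset.sum_le_sum fun ε _ => hbound ε).trans_eq ?_
    rw [Finset.sum_add_distrib, two_mul]
    congr 1
    exact (Equiv.arrowCongr (Equiv.refl (Fin n)) Equiv.boolNot).sum_comp
      fun ε => ∫ z, S ε z ∂μ
  have hrad : ∫ z, (radAvg fun i k => h i (z k)) ∂μ =
      (2 ^ n : ℝ)⁻¹ * ∑ ε : Fin n → Bool, ∫ z, S ε z ∂μ := by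
    unfold radAvg
    rw [integral_const_mul, integral_finsetSum]
    exact fun ε _ => integrable_of_measurable_of_abs_le (hSm ε) (hSB ε)
  rw [hrad]
  simp only [Finset.sum_const, Finset.card_univ, Fintype.card_fun, Fintype.card_bool,
    Fintype.card_fin, nsmul_eq_mul, Nat.cast_pow, Nat.cast_ofNat] at hsum
  rw [mul_left_comm, ← div_eq_inv_mul, le_div_iff₀ (by positivity), mul_comm]
  exact hsum

theorem measure_supDev_ge_le [Countable ι] [Nonempty ι] {n : ℕ} (hn : 0 < n) {h : ι → Z → ℝ}
    (hm : ∀ i, Measurable (h i)) {B : ℝ} (hB : ∀ i x, |h i x| ≤ B) {c : ℝ}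
    (hc : ∀ i x y, |h i x - h i y| ≤ c) {ε : ℝ} (hε : 0 ≤ ε) :
    (Measure.pi fun _ : Fin n => P).real
      {z | 2 * (∫ w, (radAvg fun i k => h i (w k)) ∂(Measure.pi fun _ : Fin n => P)) + ε ≤
        supDev P h z} ≤ Real.exp (-ε ^ 2 / (2 * (n * (c / n / 2) ^ 2))) := by
  have hn' : (0 : ℝ) < n := Nat.cast_pos.2 hn
  refine le_trans (measureReal_mono ?_ (by finiteness))
    (measure_ge_le_of_boundedDifferences P (measurable_supDev P hm)
    (fun z => abs_iSup_le (abs_dev_le P hn hB z)) (c := c / n) (fun z j x => ?_) hε)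
  · intro z hz
    have := integral_supDev_le P hn hm hB
    simp only [Set.mem_ofPred_eq] at hz ⊢
    linarith
  · refine abs_iSup_sub_iSup_le (abs_dev_le P hn hB _) (abs_dev_le P hn hB _) fun i => ?_
    have heq : ∫ y, h i y ∂P - (n : ℝ)⁻¹ * ∑ k, h i (Function.update z j x k) -
        (∫ y, h i y ∂P - (n : ℝ)⁻¹ * ∑ k, h i (z k)) =
        (n : ℝ)⁻¹ * ∑ k, (h i (z k) - h i (Function.update z j x k)) := by
      rw [Finset.sum_sub_distrib]
      ring
    rw [heq, Finset.sum_eq_single j]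
    · rw [abs_mul, abs_of_pos (inv_pos.2 hn'), ← div_eq_inv_mul]
      gcongr
      exact hc _ _ _
    · intro k _ hk
      simp [Function.update_of_ne hk]
    · simp

end Symmetrization

section Disutility

theorem inv_mul_sqrt_natCast {n : ℕ} (hn : 0 < n) : (n : ℝ)⁻¹ * √n = 1 / √n := by
  have hn' : (0 : ℝ) < n := Nat.cast_pos.2 hn
  rw [inv_mul_eq_div, Real.sqrt_div_self']

/-- Contraction for the class of translates of a family by a bounded scalar parameter. -/
theorem radAvg_comp_sub_le {κ : Type*} [Nonempty κ] {n : ℕ} (hn : 0 < n) {ψ : ℝ → ℝ} {L : ℝ}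
    (hL : 0 ≤ L) (hψ : ∀ x y, |ψ x - ψ y| ≤ L * |x - y|) {b : κ → Fin n → ℝ} {M : ℝ}
    (hb : ∀ i k, |b i k| ≤ M) {s : ℕ → ℝ} (hs : ∀ m, |s m| ≤ M) :
    (radAvg fun (p : κ × ℕ) k => ψ (b p.1 k - s p.2)) ≤ L * (radAvg b + M * (1 / √n)) := by
  have hn' : (0 : ℝ) < n := Nat.cast_pos.2 hn
  have hψ' : ∀ x y, |(n : ℝ)⁻¹ * ψ x - (n : ℝ)⁻¹ * ψ y| ≤ ((n : ℝ)⁻¹ * L) * |x - y| := by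
    intro x y
    rw [← mul_sub, abs_mul, abs_of_pos (inv_pos.2 hn'), mul_assoc]
    exact mul_le_mul_of_nonneg_left (hψ x y) (by positivity)
  have hcon := sum_iSup_contraction hψ' n (fun _ : κ × ℕ => 0) (fun p k => b p.1 k - s p.2) 0
    (M + M) (by simp) fun p k => (abs_sub _ _).trans (add_le_add (hb _ _) (hs _))
  have hleft : ∀ (ε : Fin n → Bool) (p : κ × ℕ),
      (n : ℝ)⁻¹ * ∑ k, boolSign (ε k) * ψ (b p.1 k - s p.2) =
        0 + ∑ k, boolSign (ε k) * ((n : ℝ)⁻¹ * ψ (b p.1 k - s p.2)) := by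
    intro ε p
    rw [Finset.mul_sum, zero_add]
    exact Finset.sum_congr rfl fun k _ => by ring
  have hright : ∀ ε : Fin n → Bool,
      ⨆ p : κ × ℕ, (0 + ∑ k, boolSign (ε k) * ((n : ℝ)⁻¹ * L * (b p.1 k - s p.2))) ≤
        L * (⨆ i, (n : ℝ)⁻¹ * ∑ k, boolSign (ε k) * b i k) +
          L * M * (n : ℝ)⁻¹ * |∑ k, boolSign (ε k)| := by
    intro ε
    refine ciSup_le fun p => ?_
    have h1 : 0 + ∑ k, boolSign (ε k) * ((n : ℝ)⁻¹ * L * (b p.1 k - s p.2)) =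
        L * ((n : ℝ)⁻¹ * ∑ k, boolSign (ε k) * b p.1 k) +
          L * (n : ℝ)⁻¹ * (-(s p.2 * ∑ k, boolSign (ε k))) := by
      simp only [Finset.mul_sum, ← Finset.sum_neg_distrib, ← Finset.sum_add_distrib, zero_add]
      exact Finset.sum_congr rfl fun k _ => by ring
    have h2 : -(s p.2 * ∑ k, boolSign (ε k)) ≤ M * |∑ k, boolSign (ε k)| := by
      refine (neg_le_abs _).trans ?_
      rw [abs_mul]
      exact mul_le_mul_of_nonneg_right (hs _) (abs_nonneg _)
    have h3 := le_ciSup (bddAbove_range_of_abs_le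
      fun i => abs_inv_mul_boolSign_sum_le ε hn (hb i)) p.1
    rw [h1, show L * M * (n : ℝ)⁻¹ * |∑ k, boolSign (ε k)| =
      L * (n : ℝ)⁻¹ * (M * |∑ k, boolSign (ε k)|) by ring]
    gcongr
  have hM : 0 ≤ M := (abs_nonneg _).trans (hs 0)
  unfold radAvg
  simp only [hleft]
  calc (2 ^ n : ℝ)⁻¹ * ∑ ε : Fin n → Bool, ⨆ p : κ × ℕ,
          (0 + ∑ k, boolSign (ε k) * ((n : ℝ)⁻¹ * ψ (b p.1 k - s p.2)))
      ≤ (2 ^ n : ℝ)⁻¹ * ∑ ε : Fin n → Bool,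
          (L * (⨆ i, (n : ℝ)⁻¹ * ∑ k, boolSign (ε k) * b i k) +
            L * M * (n : ℝ)⁻¹ * |∑ k, boolSign (ε k)|) := by
        refine mul_le_mul_of_nonneg_left ?_ (by positivity)
        exact hcon.trans (Finset.sum_le_sum fun ε _ => hright ε)
    _ = L * ((2 ^ n : ℝ)⁻¹ * ∑ ε : Fin n → Bool,
            ⨆ i, (n : ℝ)⁻¹ * ∑ k, boolSign (ε k) * b i k) +
          (2 ^ n : ℝ)⁻¹ * (L * M * (n : ℝ)⁻¹) * ∑ ε : Fin n → Bool, |∑ k, boolSign (ε k)| := by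
        rw [Finset.sum_add_distrib, ← Finset.mul_sum, ← Finset.mul_sum]
        ring
    _ ≤ L * ((2 ^ n : ℝ)⁻¹ * ∑ ε : Fin n → Bool,
            ⨆ i, (n : ℝ)⁻¹ * ∑ k, boolSign (ε k) * b i k) +
          (2 ^ n : ℝ)⁻¹ * (L * M * (n : ℝ)⁻¹) * (2 ^ n * √n) := by
        gcongr
        exact sum_abs_boolSign_sum_le n
    _ = L * ((2 ^ n : ℝ)⁻¹ * ∑ ε : Fin n → Bool,
            ⨆ i, (n : ℝ)⁻¹ * ∑ k, boolSign (ε k) * b i k) +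
          ((2 ^ n : ℝ)⁻¹ * 2 ^ n) * (L * M * ((n : ℝ)⁻¹ * √n)) := by ring
    _ = _ := by
        rw [inv_mul_sqrt_natCast hn, inv_mul_cancel₀ (by positivity)]
        ring

theorem IsDisutility.sub_le_sub_of_mul {φ : ℝ → ℝ} (hφ : IsDisutility φ) {θ t : ℝ}
    (h0 : 0 ≤ θ) (h1 : θ ≤ 1) : φ (θ * t) - θ * t ≤ φ t - t := by
  obtain ⟨-, hconv, hz, hge⟩ := hφ
  have h := hconv.2 (Set.mem_univ t) (Set.mem_univ 0) h0 (sub_nonneg.2 h1) (by ring)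
  simp only [smul_eq_mul, mul_zero, add_zero, hz] at h
  nlinarith [hge t]

/-- The function `φ(t) - t` increases as `t` moves away from the origin. -/
theorem IsDisutility.sub_le_sub {φ : ℝ → ℝ} (hφ : IsDisutility φ) {a b : ℝ}
    (h : 0 ≤ a ∧ a ≤ b ∨ b ≤ a ∧ a ≤ 0) : φ a - a ≤ φ b - b := by
  rcases eq_or_ne b 0 with rfl | hb
  · have : a = 0 := by rcases h with h | h <;> linarith [h.1, h.2]
    rw [this]
  · have hab : a / b * b = a := div_mul_cancel₀ a hb
    rw [← hab]
    rcases h with h | h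
    · have hb' : 0 < b := lt_of_le_of_ne (h.1.trans h.2) hb.symm
      exact hφ.sub_le_sub_of_mul (div_nonneg h.1 hb'.le) ((div_le_one hb').2 h.2)
    · have hb' : b < 0 := lt_of_le_of_ne (h.1.trans h.2) hb
      exact hφ.sub_le_sub_of_mul (div_nonneg_of_nonpos h.2 hb'.le)
        ((div_le_one_of_neg hb').2 h.1)

/-- Projecting the threshold onto the range of the loss does not increase the objective. -/
theorem IsDisutility.add_projIcc_le {φ : ℝ → ℝ} (hφ : IsDisutility φ) {M : ℝ} (hM : 0 ≤ M)
    {y : ℝ} (hy : y ∈ Set.Icc 0 M) (lam : ℝ) :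
    (Set.projIcc 0 M hM lam : ℝ) + φ (y - Set.projIcc 0 M hM lam) ≤ lam + φ (y - lam) := by
  rcases le_total lam 0 with h | h
  · rw [Set.projIcc_of_le_left hM h]
    have := hφ.sub_le_sub (a := y - 0) (b := y - lam) (Or.inl ⟨by linarith [hy.1], by linarith⟩)
    simp only
    linarith
  rcases le_total M lam with h' | h'
  · rw [Set.projIcc_of_right_le hM h']
    have := hφ.sub_le_sub (a := y - M) (b := y - lam) (Or.inr ⟨by linarith, by linarith [hy.2]⟩)
    simp only
    linarith
  · rw [Set.projIcc_of_mem hM ⟨h, h'⟩]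

theorem continuous_of_abs_sub_le {ψ : ℝ → ℝ} {L : ℝ}
    (hψ : ∀ x y, |ψ x - ψ y| ≤ L * |x - y|) : Continuous ψ := by
  refine (LipschitzWith.of_dist_le_mul (K := L.toNNReal) fun x y => ?_).continuous
  rw [Real.dist_eq, Real.dist_eq]
  exact (hψ x y).trans (mul_le_mul_of_nonneg_right (Real.le_coe_toNNReal L) (abs_nonneg _))

theorem abs_comp_sub_le {ψ : ℝ → ℝ} {L : ℝ} (hL : 0 ≤ L)
    (hψ : ∀ x y, |ψ x - ψ y| ≤ L * |x - y|) (h0 : ψ 0 = 0) {M y : ℝ} (hy : y ∈ Set.Icc 0 M)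
    (lam : ℝ) : |ψ (y - lam)| ≤ L * (M + |lam|) := by
  have h := hψ (y - lam) 0
  rw [h0, sub_zero, sub_zero] at h
  refine h.trans (mul_le_mul_of_nonneg_left ((abs_sub _ _).trans ?_) hL)
  rw [abs_of_nonneg hy.1]
  linarith [hy.2]

variable {Z : Type*} [MeasurableSpace Z]

theorem integrable_comp_sub {φ : ℝ → ℝ} {L : ℝ} (hL : 0 ≤ L)
    (hφL : ∀ x y, |φ x - φ y| ≤ L * |x - y|) (h0 : φ 0 = 0) {M : ℝ} {f : Z → ℝ}
    (hf : Measurable f) (hfM : ∀ z, f z ∈ Set.Icc 0 M) (Q : Measure Z) [IsFiniteMeasure Q]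
    (lam : ℝ) : Integrable (fun z => φ (f z - lam)) Q :=
  integrable_of_measurable_of_abs_le
    ((continuous_of_abs_sub_le hφL).measurable.comp (hf.sub_const lam))
    fun z => abs_comp_sub_le hL hφL h0 (hfM z) lam

theorem continuous_add_integral_comp_sub {φ : ℝ → ℝ} {L : ℝ} (hL : 0 ≤ L)
    (hφL : ∀ x y, |φ x - φ y| ≤ L * |x - y|) (h0 : φ 0 = 0) {M : ℝ} {f : Z → ℝ}
    (hf : Measurable f) (hfM : ∀ z, f z ∈ Set.Icc 0 M) (Q : Measure Z) [IsProbabilityMeasure Q] :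
    Continuous fun lam : ℝ => lam + ∫ z, φ (f z - lam) ∂Q := by
  refine continuous_id.add (continuous_of_abs_sub_le (L := L) fun x y => ?_)
  rw [← integral_sub (integrable_comp_sub hL hφL h0 hf hfM Q x)
    (integrable_comp_sub hL hφL h0 hf hfM Q y)]
  refine abs_integral_le_of_abs_le Q fun z => (hφL _ _).trans_eq ?_
  rw [abs_sub_comm x y]
  congr 2
  ring

theorem IsDisutility.objective_nonneg {φ : ℝ → ℝ} (hφ : IsDisutility φ) {L : ℝ} (hL : 0 ≤ L)
    (hφL : ∀ x y, |φ x - φ y| ≤ L * |x - y|) {M : ℝ} {f : Z → ℝ}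
    (hf : Measurable f) (hfM : ∀ z, f z ∈ Set.Icc 0 M) (Q : Measure Z) [IsProbabilityMeasure Q] :
    ∀ lam : ℝ, 0 ≤ lam + ∫ z, φ (f z - lam) ∂Q := by
  intro lam
  have h : ∫ _z, -lam ∂Q ≤ ∫ z, φ (f z - lam) ∂Q :=
    integral_mono (integrable_const _) (integrable_comp_sub hL hφL hφ.2.2.1 hf hfM Q lam)
      fun z => by linarith [hφ.2.2.2 (f z - lam), (hfM z).1]
  simp only [integral_const, probReal_univ, one_smul] at h
  linarith

theorem IsDisutility.OCE_nonneg {φ : ℝ → ℝ} (hφ : IsDisutility φ) {L : ℝ} (hL : 0 ≤ L)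
    (hφL : ∀ x y, |φ x - φ y| ≤ L * |x - y|) {M : ℝ} {f : Z → ℝ}
    (hf : Measurable f) (hfM : ∀ z, f z ∈ Set.Icc 0 M) (Q : Measure Z) [IsProbabilityMeasure Q] :
    0 ≤ OCE φ f Q :=
  le_ciInf (hφ.objective_nonneg hL hφL hf hfM Q)

/-- Comparing two measures on a dense set of thresholds in `[0, M]` compares the OCE risks. -/
theorem IsDisutility.OCE_le_OCE_add {φ : ℝ → ℝ} (hφ : IsDisutility φ) {L : ℝ} (hL : 0 ≤ L)
    (hφL : ∀ x y, |φ x - φ y| ≤ L * |x - y|) {M : ℝ} (hM : 0 ≤ M) {f : Z → ℝ}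
    (hf : Measurable f) (hfM : ∀ z, f z ∈ Set.Icc 0 M) (Q Q' : Measure Z)
    [IsProbabilityMeasure Q] [IsProbabilityMeasure Q'] {s : ℕ → Set.Icc (0 : ℝ) M}
    (hs : DenseRange s) {T : ℝ}
    (hT : ∀ m, ∫ z, φ (f z - s m) ∂Q ≤ ∫ z, φ (f z - s m) ∂Q' + T) :
    OCE φ f Q ≤ OCE φ f Q' + T := by
  have h0 := hφ.2.2.1
  have hdense : ∀ x : Set.Icc (0 : ℝ) M,
      OCE φ f Q ≤ ((x : ℝ) + ∫ z, φ (f z - x) ∂Q') + T := by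
    intro x
    induction x using hs.induction_on with
    | hp =>
      exact isClosed_le continuous_const (((continuous_add_integral_comp_sub hL hφL h0 hf hfM
        Q').comp continuous_subtype_val).add continuous_const)
    | ih m =>
      have h : OCE φ f Q ≤ (s m : ℝ) + ∫ z, φ (f z - s m) ∂Q := by
        refine ciInf_le ⟨0, ?_⟩ (s m : ℝ)
        rintro _ ⟨lam, rfl⟩
        exact hφ.objective_nonneg hL hφL hf hfM Q lam
      linarith [hT m]
  rw [← sub_le_iff_le_add]
  refine le_ciInf fun lam => ?_
  rw [sub_le_iff_le_add]
  refine (hdense (Set.projIcc 0 M hM lam)).trans (add_le_add_left ?_ _)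
  have hi := fun lam => integrable_comp_sub hL hφL h0 hf hfM Q' lam
  have hmono : ∫ z, ((Set.projIcc 0 M hM lam : ℝ) + φ (f z - Set.projIcc 0 M hM lam)) ∂Q' ≤
      ∫ z, (lam + φ (f z - lam)) ∂Q' :=
    integral_mono ((integrable_const _).add (hi _)) ((integrable_const _).add (hi _))
      fun z => hφ.add_projIcc_le hM (hfM z) lam
  rwa [integral_add (integrable_const _) (hi _), integral_add (integrable_const _) (hi _),
    integral_const, integral_const, probReal_univ, one_smul, one_smul] at hmono

theorem isProbabilityMeasure_empMeas {n : ℕ} (hn : 0 < n) (z : Fin n → Z) :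
    IsProbabilityMeasure (empMeas z) := by
  refine ⟨?_⟩
  have h0 : (n : ℝ≥0∞) ≠ 0 := by exact_mod_cast hn.ne'
  simp [empMeas, ENNReal.inv_mul_cancel h0 (ENNReal.natCast_ne_top n)]

theorem integral_empMeas {n : ℕ} (z : Fin n → Z) {g : Z → ℝ} (hg : Measurable g) :
    ∫ x, g x ∂(empMeas z) = (n : ℝ)⁻¹ * ∑ k, g (z k) := by
  rw [empMeas, integral_smul_measure, integral_finsetSum_measure]
  · simp [integral_dirac' g _ hg.stronglyMeasurable]
  · exact fun k _ => integrable_dirac' hg.stronglyMeasurable (by simp)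

/-- Uniform one-sided deviation bound for a Lipschitz transformation of translates of `F`. -/
theorem measure_exists_dev_gt_le (P : Measure Z) [IsProbabilityMeasure P] {M : ℝ} (hM : 0 < M)
    {F : Set (Z → ℝ)} (hFc : F.Countable) (hFne : F.Nonempty)
    (hFmeas : ∀ f ∈ F, Measurable f) (hFbd : ∀ f ∈ F, ∀ z, f z ∈ Set.Icc 0 M)
    {ψ : ℝ → ℝ} {L : ℝ} (hL : 0 < L) (hψ : ∀ x y, |ψ x - ψ y| ≤ L * |x - y|) (h0 : ψ 0 = 0)
    (s : ℕ → Set.Icc (0 : ℝ) M) {n : ℕ} (hn : 0 < n) {δ : ℝ} (hδ : δ ∈ Set.Ioc (0 : ℝ) 1) :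
    (Measure.pi fun _ : Fin n => P).real
      {z | ∃ f ∈ F, ∃ m, ∫ x, ψ (f x - s m) ∂(empMeas z) +
        L * (2 * (∫ w, rad F w ∂(Measure.pi fun _ : Fin n => P)) +
          M * (2 + √(Real.log (2 / δ))) / √n) < ∫ x, ψ (f x - s m) ∂P} ≤ δ / 2 := by
  have hn' : (0 : ℝ) < n := Nat.cast_pos.2 hn
  have := hFc.to_subtype
  have := hFne.to_subtype
  set μ := Measure.pi fun _ : Fin n => P
  set h : F × ℕ → Z → ℝ := fun p x => ψ ((p.1 : Z → ℝ) x - s p.2) with hh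
  have hfm : ∀ f : F, Measurable (f : Z → ℝ) := fun f => hFmeas f f.2
  have hfB : ∀ (f : F) x, |(f : Z → ℝ) x| ≤ M := fun f x => by
    rw [abs_of_nonneg (hFbd f f.2 x).1]
    exact (hFbd f f.2 x).2
  have hsM : ∀ m, |(s m : ℝ)| ≤ M := fun m => by
    rw [abs_of_nonneg (s m).2.1]
    exact (s m).2.2
  have hm : ∀ p, Measurable (h p) := fun p =>
    (continuous_of_abs_sub_le hψ).measurable.comp ((hfm p.1).sub_const _)
  have hB : ∀ p x, |h p x| ≤ L * (M + M) := fun p x =>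
    (abs_comp_sub_le hL.le hψ h0 (hFbd p.1 p.1.2 x) _).trans (by gcongr; exact hsM _)
  have hc : ∀ p x y, |h p x - h p y| ≤ L * M := fun p x y => by
    refine (hψ _ _).trans (mul_le_mul_of_nonneg_left ?_ hL.le)
    have hx := hFbd p.1 p.1.2 x
    have hy := hFbd p.1 p.1.2 y
    exact abs_le.2 ⟨by linarith [hx.1, hy.2], by linarith [hx.2, hy.1]⟩
  have hradF : ∀ w : Fin n → Z, rad F w = radAvg fun (f : F) k => (f : Z → ℝ) (w k) :=
    fun _ => rfl
  have hradi : Integrable (fun w : Fin n → Z => rad F w) μ := by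
    simp only [hradF]
    exact integrable_of_measurable_of_abs_le (measurable_radAvg hfm)
      fun w => abs_radAvg_le hn fun f k => hfB f (w k)
  have hpt : ∀ w : Fin n → Z,
      (radAvg fun p k => h p (w k)) ≤ L * (rad F w + M * (1 / √n)) := fun w => by
    rw [hradF]
    exact radAvg_comp_sub_le hn hL.le hψ (b := fun (f : F) k => (f : Z → ℝ) (w k))
      (s := fun m => (s m : ℝ)) (fun f k => hfB f (w k)) hsM
  have hrhs : Integrable (fun w : Fin n → Z => L * (rad F w + M * (1 / √n))) μ :=
    (hradi.add (integrable_const _)).const_mul L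
  have hrad : ∫ w, (radAvg fun p k => h p (w k)) ∂μ ≤
      L * (∫ w, rad F w ∂μ + M * (1 / √n)) := by
    calc ∫ w, (radAvg fun p k => h p (w k)) ∂μ
        ≤ ∫ w, L * (rad F w + M * (1 / √n)) ∂μ := by
          refine integral_mono ?_ hrhs hpt
          exact integrable_of_measurable_of_abs_le (measurable_radAvg hm)
            fun w => abs_radAvg_le hn fun p k => hB p (w k)
      _ = _ := by
          rw [integral_const_mul, integral_add hradi (integrable_const _)]
          simp
  set r := √(Real.log (2 / δ)) with hr
  have hlog : 0 ≤ Real.log (2 / δ) :=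
    Real.log_nonneg ((one_le_div hδ.1).2 (by linarith [hδ.2]))
  have hdev := measure_supDev_ge_le P hn hm hB hc (ε := L * M * r / √n) (by positivity)
  have hexp : Real.exp (-(L * M * r / √n) ^ 2 / (2 * (n * (L * M / n / 2) ^ 2))) ≤ δ / 2 := by
    have hsq : √(n : ℝ) ^ 2 = n := Real.sq_sqrt hn'.le
    have hr2 : r ^ 2 = Real.log (2 / δ) := Real.sq_sqrt hlog
    have heq : -(L * M * r / √n) ^ 2 / (2 * (n * (L * M / n / 2) ^ 2)) = -(2 * r ^ 2) := by
      rw [div_pow, hsq]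
      field_simp
    rw [heq, hr2]
    calc Real.exp (-(2 * Real.log (2 / δ))) ≤ Real.exp (-Real.log (2 / δ)) :=
          Real.exp_le_exp.2 (by linarith)
      _ = δ / 2 := by
          rw [Real.exp_neg, Real.exp_log (div_pos two_pos hδ.1), inv_div]
  refine (measureReal_mono ?_ (by finiteness)).trans (hdev.trans hexp)
  rintro z ⟨f, hf, m, hlt⟩
  have hle := le_ciSup (bddAbove_range_of_abs_le (abs_dev_le P hn hB z)) (⟨f, hf⟩, m)
  rw [integral_empMeas z (hm (⟨f, hf⟩, m))] at hlt
  change 2 * _ + L * M * r / √n ≤ supDev P h z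
  refine le_trans ?_ hle
  have hsplit : L * (2 * (∫ w, rad F w ∂μ) + M * (2 + r) / √n) =
      2 * (L * (∫ w, rad F w ∂μ + M * (1 / √n))) + L * M * r / √n := by ring
  change _ ≤ ∫ x, ψ (f x - s m) ∂P - (n : ℝ)⁻¹ * ∑ k, ψ (f (z k) - s m)
  linarith

end Disutility

/-- OCE guarantee for the empirical OCE minimizer.  With probability at least
`1 − δ` over the sample, every minimizer of the empirical OCE over `F` has population OCE
within `L·(4·E[Rad] + 2M(2 + √log(2/δ))/√n)` of the best-in-class population OCE. -/
theorem oce_guarantee {Z : Type*} [MeasurableSpace Z]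
    (P : Measure Z) [IsProbabilityMeasure P] (M : ℝ) (hM : 0 < M)
    (F : Set (Z → ℝ)) (hFc : F.Countable) (hFne : F.Nonempty)
    (hFmeas : ∀ f ∈ F, Measurable f) (hFbd : ∀ f ∈ F, ∀ z, f z ∈ Set.Icc 0 M)
    (φ : ℝ → ℝ) (hφ : IsDisutility φ)
    (L : ℝ) (hL : ∀ x y : ℝ, |φ x - φ y| ≤ L * |x - y|)
    (n : ℕ) (hn : 1 ≤ n) (δ : ℝ) (hδ : δ ∈ Set.Ioc (0 : ℝ) 1) :
    ENNReal.ofReal (1 - δ) ≤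
      (Measure.pi fun _ : Fin n => P)
        {z : Fin n → Z |
          ∀ fhat ∈ F, (∀ g ∈ F, OCE φ fhat (empMeas z) ≤ OCE φ g (empMeas z)) →
            OCE φ fhat P ≤ (⨅ g : F, OCE φ (g : Z → ℝ) P) +
              L * (4 * (∫ w, rad F w ∂(Measure.pi fun _ : Fin n => P)) +
                2 * M * (2 + Real.sqrt (Real.log (2 / δ))) / Real.sqrt n)} := by
  have hn' : 0 < n := hn
  have h0 := hφ.2.2.1
  have hL1 : 0 < L := by
    have h := hL 1 0
    rw [h0, sub_zero, sub_zero, abs_one, mul_one] at h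
    linarith [hφ.2.2.2 1, le_abs_self (φ 1)]
  have : Nonempty (Set.Icc (0 : ℝ) M) := ⟨⟨0, le_refl _, hM.le⟩⟩
  have hs := TopologicalSpace.denseRange_denseSeq (Set.Icc (0 : ℝ) M)
  set s := TopologicalSpace.denseSeq (Set.Icc (0 : ℝ) M)
  set μ := Measure.pi fun _ : Fin n => P
  have hupper := measure_exists_dev_gt_le P hM hFc hFne hFmeas hFbd hL1 hL h0 s hn' hδ
  have hlower := measure_exists_dev_gt_le P hM hFc hFne hFmeas hFbd (ψ := fun t => -φ t) hL1
    (fun x y => by rw [neg_sub_neg, abs_sub_comm]; exact hL x y) (by simp [h0]) s hn' hδ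
  set T := L * (2 * (∫ w, rad F w ∂μ) + M * (2 + √(Real.log (2 / δ))) / √n) with hT
  set U := {z : Fin n → Z | ∃ f ∈ F, ∃ m, ∫ x, φ (f x - s m) ∂(empMeas z) + T <
    ∫ x, φ (f x - s m) ∂P}
  set V := {z : Fin n → Z | ∃ f ∈ F, ∃ m, ∫ x, -φ (f x - s m) ∂(empMeas z) + T <
    ∫ x, -φ (f x - s m) ∂P}
  have hUV : μ.real (U ∪ V) ≤ δ := (measureReal_union_le U V).trans (by linarith)
  have hcompl : ENNReal.ofReal (1 - δ) ≤ μ (U ∪ V)ᶜ := by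
    have h1 : (1 : ℝ≥0∞) ≤ μ (U ∪ V) + μ (U ∪ V)ᶜ := by
      rw [← measure_univ (μ := μ), ← Set.union_compl_self (U ∪ V)]
      exact measure_union_le _ _
    have h2 : μ (U ∪ V) ≤ ENNReal.ofReal δ := by
      rw [← ofReal_measureReal]
      exact ENNReal.ofReal_le_ofReal hUV
    rw [ENNReal.ofReal_sub _ hδ.1.le, ENNReal.ofReal_one, tsub_le_iff_left]
    exact h1.trans (add_le_add_left h2 _)
  refine hcompl.trans (measure_mono fun z hz fhat hfhat hmin => ?_)
  have := isProbabilityMeasure_empMeas hn' z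
  have := hFne.to_subtype
  simp only [Set.mem_compl_iff, Set.mem_union, not_or] at hz
  have hU : ∀ f ∈ F, OCE φ f P ≤ OCE φ f (empMeas z) + T := fun f hf =>
    hφ.OCE_le_OCE_add hL1.le hL hM.le (hFmeas f hf) (hFbd f hf) P (empMeas z) hs fun m =>
      not_lt.1 fun h => hz.1 ⟨f, hf, m, h⟩
  have hV : ∀ f ∈ F, OCE φ f (empMeas z) ≤ OCE φ f P + T := fun f hf =>
    hφ.OCE_le_OCE_add hL1.le hL hM.le (hFmeas f hf) (hFbd f hf) (empMeas z) P hs fun m =>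
      not_lt.1 fun h => hz.2 ⟨f, hf, m, by
        rw [integral_neg, integral_neg]
        linarith⟩
  have hinf : OCE φ fhat P - 2 * T ≤ ⨅ g : F, OCE φ (g : Z → ℝ) P := le_ciInf fun g => by
    linarith [hU fhat hfhat, hmin g g.2, hV g g.2]
  have htwo : L * (4 * (∫ w, rad F w ∂μ) +
      2 * M * (2 + √(Real.log (2 / δ))) / √n) = 2 * T := by
    rw [hT]
    ring
  linarith
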